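/- arXiv:1501.03602 — 2 statements merged into one kernel-verified Lean document; each statement's English description precedes it below -/
import Mathlib

section
/- Let x, y be words over an alphabet A that do not commute, and let X = {x, y}. Let C be the set of all words w ∈ X* with w ∉ {x, y, empty word} that are X-primitive but imprimitive. Then either C is empty, or there exists k ≥ 1 such that C = {x^i y x^(k−i) : 0 ≤ i ≤ k} or C = {y^i x y^(k−i) : 0 ≤ i ≤ k}. -/
/-- A word is imprimitive if it is a proper power. -/
def IsImprimitiveWord {A : Type*} (w : FreeMonoid A) : Prop :=
  ∃ (z : FreeMonoid A) (m : ℕ), 2 ≤ m ∧ w = z ^ m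

theorem toLex_le_iff_of_agree {A : Type*} [LinearOrder A] (W : ℕ → A) (p q o : ℕ)
    (h : ∀ k < o, W (p + k) = W (q + k)) :
    toLex (fun k => W (p + k)) ≤ toLex (fun k => W (q + k)) ↔
      toLex (fun k => W (p + o + k)) ≤ toLex (fun k => W (q + o + k)) := by
  rw [← not_lt, ← not_lt, not_iff_not]
  constructor
  · rintro ⟨k, hk, hlt⟩
    have hok : o ≤ k := by
      by_contra! hko
      exact absurd (h k hko) (ne_of_gt hlt)
    obtain ⟨r, rfl⟩ := Nat.exists_eq_add_of_le hok
    refine ⟨r, fun j hj => ?_, ?_⟩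
    · simpa [add_assoc] using hk (o + j) (by simpa using hj)
    · simpa [add_assoc] using hlt
  · rintro ⟨k, hk, hlt⟩
    refine ⟨o + k, fun j hj => ?_, ?_⟩
    · by_cases hjo : j < o
      · exact (h j hjo).symm
      · obtain ⟨r, rfl⟩ := Nat.exists_eq_add_of_le (not_lt.mp hjo)
        simpa [add_assoc] using hk r (by simpa using hj)
    · simpa [add_assoc] using hlt

theorem exists_letter_unique_occurrence {A : Type*} [LinearOrder A] (f : Bool → List A)
    (w : ℕ → Bool) (W : ℕ → A) (T : ℕ → ℕ) (n L : ℕ) (a b : A) (hab : a < b)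
    (ha : (f false)[0]? = some a) (hb : (f true)[0]? = some b)
    (hT : ∀ i, T (i + 1) = T i + (f (w i)).length)
    (hW : ∀ i o, o < (f (w i)).length → (f (w i))[o]? = some (W (T i + o)))
    (hn : 0 < n) (hWn : ∀ p, W (p + n) = W p) (hL : 0 < L) (hwL : ∀ i, w (i + L) = w i)
    (hTL : ∀ i, T i + 2 * n ≤ T (i + L)) (hTW : ∀ i k, W (T (i + L) + k) = W (T i + k))
    (hprim : ∀ i j, (∀ k, w (i + k) = w (j + k)) → i ≡ j [MOD L])
    (h0 : ∃ i, w i = false) (h1 : ∃ i, w i = true) :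
    ∃ c, ∀ i j, w i = c → w j = c → i ≡ j [MOD L] := by
  have hpos : ∀ c, 0 < (f c).length := by
    intro c
    by_contra! hc
    have : f c = [] := List.length_eq_zero_iff.mp (by omega)
    cases c <;> simp [this] at ha hb
  have hTmono : StrictMono T := strictMono_nat_of_lt_succ fun i => by
    have := hpos (w i); rw [hT]; omega
  have hL2 : 2 ≤ L := by
    by_contra! hL1
    obtain rfl : L = 1 := by omega
    have hc : ∀ i, w i = w 0 := fun i => by
      induction i with
      | zero => rfl
      | succ i ih => rw [hwL, ih]
    obtain ⟨i, hi⟩ := h0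
    obtain ⟨j, hj⟩ := h1
    rw [hc] at hi hj
    simp_all
  set R : ℕ → Lex (ℕ → A) := fun p => toLex (fun k => W (p + k))
  have hagree : ∀ i j, w i = w j → ∀ o ≤ (f (w i)).length, ∀ k < o,
      W (T i + k) = W (T j + k) := by
    intro i j hij o ho k hk
    have h2 := hW i k (by omega)
    have h3 := hW j k (by rw [← hij]; omega)
    rw [hij] at h2
    exact Option.some.inj (h2.symm.trans h3)
  have hle : ∀ i j, w i = w j → ∀ o ≤ (f (w i)).length,
      (R (T i) ≤ R (T j) ↔ R (T i + o) ≤ R (T j + o)) := fun i j hij o ho =>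
    toLex_le_iff_of_agree W _ _ o (hagree i j hij o ho)
  have hsucc : ∀ i j, w i = w j → (R (T i) ≤ R (T j) ↔ R (T (i + 1)) ≤ R (T (j + 1))) := by
    intro i j hij
    rw [hT, hT, ← hij]
    exact hle i j hij _ le_rfl
  have hft : ∀ i j, w i = false → w j = true → R (T i) < R (T j) := by
    intro i j hi hj
    refine ⟨0, fun k hk => absurd hk (by simp), ?_⟩
    have h2 := hW i 0 (hpos _)
    have h3 := hW j 0 (hpos _)
    rw [hi, ha] at h2
    rw [hj, hb] at h3
    change W (T i + 0) < W (T j + 0)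
    rwa [← Option.some.inj h2, ← Option.some.inj h3]
  have hdec : ∀ i j, R (T i) = R (T j) → i ≡ j [MOD L] := by
    intro i j hij
    have hw : ∀ i j, R (T i) = R (T j) → w i = w j := by
      intro i j hij
      by_contra hne
      cases hi : w i <;> cases hj : w j <;> simp [hi, hj] at hne
      · exact absurd hij (hft i j hi hj).ne
      · exact absurd hij (hft j i hj hi).ne'
    have : ∀ k, R (T (i + k)) = R (T (j + k)) := by
      intro k
      induction k with
      | zero => exact hij
      | succ k ih =>
        have := hw _ _ ih
        exact le_antisymm ((hsucc _ _ this).mp ih.le) ((hsucc _ _ this.symm).mp ih.ge)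
    exact hprim i j fun k => hw _ _ (this k)
  have hRn : ∀ k p, R (p + n * k) = R p := by
    intro k
    induction k with
    | zero => simp
    | succ k ih =>
      intro p
      rw [← ih p]
      refine congrArg toLex (funext fun r => ?_)
      rw [← hWn (p + n * k + r)]
      congr 1
      ring
  have hRmod : ∀ p, R p = R (p % n) := fun p => by
    conv_lhs => rw [← Nat.mod_add_div p n]
    exact hRn _ _
  have hRTL : ∀ i, R (T (i + L)) = R (T i) := fun i => congrArg toLex (funext (hTW i))
  have hRTmod : ∀ i, R (T i) = R (T (i % L)) := fun i => by
    conv_lhs => rw [← Nat.mod_add_div i L]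
    generalize i / L = k
    induction k with
    | zero => simp
    | succ k ih => rw [Nat.mul_succ, ← add_assoc, hRTL, ih]
  -- the lexicographically largest boundary suffix and the boundary before it
  obtain ⟨i₀, hmax⟩ : ∃ i₀, ∀ i, R (T i) ≤ R (T (i₀ + 1)) := by
    obtain ⟨i, -, hi⟩ := (Finset.range L).exists_max_image (fun i => R (T i)) ⟨0, by simpa⟩
    refine ⟨i + L - 1, fun j => ?_⟩
    rw [Nat.sub_add_cancel (by omega), hRTL, hRTmod j]
    exact hi _ (by simpa using Nat.mod_lt _ hL)
  have hw1 : w (i₀ + 1) = true := by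
    by_contra hne
    obtain ⟨j, hj⟩ := h1
    exact absurd (hmax j) (not_le.mpr (hft _ _ (by simpa using hne) hj))
  have hmax0 : ∀ j, w j = w i₀ → R (T j) ≤ R (T i₀) := fun j hj =>
    (hsucc _ _ hj).mpr (hmax _)
  have hw0 : w i₀ = false := by
    by_contra hne
    have h2 := hdec _ _ (le_antisymm (hmax i₀) (hmax0 _ (by simp_all)))
    have h3 := (Nat.modEq_iff_dvd' (Nat.le_succ i₀)).mp h2
    simp at h3
    omega
  have harc : ∀ i p, T i ≤ p → ∃ j, i ≤ j ∧ ∃ o < (f (w j)).length, p = T j + o := by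
    intro i p hp
    induction p, hp using Nat.le_induction with
    | base => exact ⟨i, le_rfl, 0, hpos _, rfl⟩
    | succ p _ ih =>
      obtain ⟨j, hj, o, ho, rfl⟩ := ih
      by_cases h2 : o + 1 < (f (w j)).length
      · exact ⟨j, hj, o + 1, h2, rfl⟩
      · exact ⟨j + 1, by omega, 0, hpos _, by rw [hT]; omega⟩
  have hbest : ∀ i, ∃ i', (i' = i₀ ∨ i' = i₀ + 1) ∧ w i = w i' ∧
      ∀ j, w j = w i' → R (T j) ≤ R (T i') := by
    intro i
    cases hi : w i
    · exact ⟨i₀, Or.inl rfl, hw0.symm, hmax0⟩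
    · exact ⟨i₀ + 1, Or.inr rfl, hw1.symm, fun j _ => hmax j⟩
  obtain ⟨q, -, hq⟩ := (Finset.range n).exists_max_image R ⟨0, by simpa⟩
  obtain ⟨q', -, hq'⟩ := (Finset.range n).exists_min_image R ⟨0, by simpa⟩
  have hq : ∀ p, R p ≤ R q := fun p => by
    rw [hRmod p]; exact hq _ (by simpa using Nat.mod_lt _ hn)
  have hq' : ∀ p, R q' ≤ R p := fun p => by
    rw [hRmod p]; exact hq' _ (by simpa using Nat.mod_lt _ hn)
  have hrep : ∀ q s, ∃ p, s ≤ p ∧ p < s + n ∧ R p = R q := by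
    intro q s
    have h2 := Nat.mod_add_div (q + n * s - s) n
    have h3 := Nat.mod_lt (q + n * s - s) hn
    have h4 : s ≤ n * s := Nat.le_mul_of_pos_left s hn
    refine ⟨s + (q + n * s - s) % n, by omega, by omega, ?_⟩
    rw [← hRn ((q + n * s - s) / n), ← hRn s q]
    congr 1
    omega
  obtain ⟨p, hp1, hp2, hp⟩ := hrep q (T i₀)
  have hpn : p + n < T (i₀ + 2) := by
    obtain ⟨i, hi, o, ho, hio⟩ := harc i₀ (p + n) (by omega)
    obtain ⟨i', hi', hw', hmax'⟩ := hbest i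
    have h2 : R (T i + o) = R q := by
      rw [← hio, ← hp]; simpa using hRn 1 p
    have h3 : R (T i) = R (T i') := by
      refine le_antisymm (hmax' _ hw') ((hle _ _ hw'.symm o ?_).mpr ?_)
      · rw [← hw']; exact ho.le
      · rw [h2]; exact hq _
    have h4 : i < i₀ + L := by
      rw [← hTmono.lt_iff_lt]
      have := hTL i₀
      omega
    have h5 : i = i' := by
      have h6 := hdec _ _ h3
      by_contra hne
      rcases lt_or_gt_of_ne hne with h | h
      · have := Nat.le_of_dvd (by omega) ((Nat.modEq_iff_dvd' h.le).mp h6)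
        omega
      · have := Nat.le_of_dvd (by omega) ((Nat.modEq_iff_dvd' h.le).mp h6.symm)
        omega
    have h6 : T (i + 1) ≤ T (i₀ + 2) := hTmono.monotone (by omega)
    rw [hT] at h6
    omega
  obtain ⟨p', hp1', hp2', hp'⟩ := hrep q' p
  obtain ⟨i, hi, o, ho, rfl⟩ := harc i₀ p' (by omega)
  have hi2 : i < i₀ + 2 := by
    rw [← hTmono.lt_iff_lt]; omega
  have hmaxi : ∀ j, w j = w i → R (T j) ≤ R (T i) := by
    obtain rfl | rfl : i = i₀ ∨ i = i₀ + 1 := by omega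
    · exact hmax0
    · exact fun j _ => hmax j
  have key : ∀ j, w j = w i → j ≡ i [MOD L] := fun j hj =>
    hdec _ _ (le_antisymm (hmaxi j hj) ((hle _ _ hj.symm o ho.le).mpr (by rw [hp']; exact hq' _)))
  exact ⟨w i, fun j k hj hk => (key j hj).trans (key k hk).symm⟩

theorem exists_linearOrder_lt {A : Type*} {a b : A} (hab : a ≠ b) :
    ∃ _ : LinearOrder A, a < b := by
  classical
  obtain ⟨o⟩ : Nonempty (LinearOrder A) := ⟨linearOrderOfSTO WellOrderingRel⟩
  rcases lt_or_gt_of_ne hab with h | h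
  · exact ⟨o, h⟩
  · exact ⟨inferInstanceAs (LinearOrder Aᵒᵈ), h⟩

namespace FreeMonoid

variable {A : Type*}

theorem length_pow (z : FreeMonoid A) (m : ℕ) : (z ^ m).length = m * z.length := by
  induction m with
  | zero => simp
  | succ m ih => rw [pow_succ, length_mul, ih]; ring

theorem count_toList_pow [DecidableEq A] (z : FreeMonoid A) (m : ℕ) (c : A) :
    (z ^ m).toList.count c = m * z.toList.count c := by
  induction m with
  | zero => simp
  | succ m ih => rw [pow_succ, toList_mul, List.count_append, ih]; ring

theorem getElem?_toList_pow (z : FreeMonoid A) (a : A) (m p : ℕ) (hp : p < m * z.length) :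
    (z ^ m).toList[p]? = some (z.toList.getD (p % z.length) a) := by
  induction m generalizing p with
  | zero => simp at hp
  | succ m ih =>
    rw [pow_succ', toList_mul]
    by_cases h : p < z.length
    · rw [Nat.mod_eq_of_lt h, List.getElem?_append_left h]
      simp [List.getD_eq_getElem?_getD, List.getElem?_eq_getElem (show p < z.toList.length from h)]
    · push Not at h
      rw [List.getElem?_append_right h, Nat.mod_eq_sub_mod h]
      exact ih _ (by change p - z.length < _; rw [Nat.add_mul] at hp; omega)

theorem dvd_of_dvd_of_length_le {a b c : FreeMonoid A} (ha : a ∣ c) (hb : b ∣ c)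
    (h : a.length ≤ b.length) : a ∣ b := by
  obtain ⟨a', rfl⟩ := ha
  obtain ⟨b', hb⟩ := hb
  have h1 : a.toList <+: (a * a').toList := ⟨a'.toList, rfl⟩
  have h2 : b.toList <+: (a * a').toList := ⟨b'.toList, congrArg toList hb.symm⟩
  obtain ⟨t, ht⟩ := List.prefix_of_prefix_length_le h1 h2 h
  exact ⟨ofList t, ht.symm⟩

theorem eq_of_dvd_of_length_eq {a b c : FreeMonoid A} (ha : a ∣ c) (hb : b ∣ c)
    (h : a.length = b.length) : a = b := by
  obtain ⟨t, rfl⟩ := dvd_of_dvd_of_length_le ha hb h.le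
  have : t = 1 := by
    rw [length_mul] at h
    exact length_eq_zero.mp (by omega)
  simp [this]

theorem mul_dvd_of_dvd_pow {u v s : FreeMonoid A} {i : ℕ} (hu : s ∣ u ^ i) (hv : v ∣ s)
    (h : u.length + v.length ≤ s.length) : u * v ∣ s := by
  obtain _ | k := i
  · have : s.length = 0 := by
      obtain ⟨t, ht⟩ := hu
      have := congrArg length ht
      rw [pow_zero, length_mul, length_one] at this
      omega
    rw [length_eq_zero.mp (show u.length = 0 by omega),
      length_eq_zero.mp (show v.length = 0 by omega)]
    simp
  · obtain ⟨s', rfl⟩ := dvd_of_dvd_of_length_le (dvd_pow_self u k.succ_ne_zero) hu (by omega)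
    have hs' : s' ∣ u ^ (k + 1) := by
      obtain ⟨t, ht⟩ := hu
      rw [pow_succ', mul_assoc] at ht
      exact (Dvd.intro t (mul_left_cancel ht).symm).trans (pow_dvd_pow u k.le_succ)
    exact mul_dvd_mul_left u (dvd_of_dvd_of_length_le (hv.trans hu) hs'
      (by rw [length_mul] at h; omega))

/-- The periodicity lemma of Fine and Wilf, in a weak form. -/
theorem commute_of_dvd_pow {u v s : FreeMonoid A} {i j : ℕ} (hu : s ∣ u ^ i) (hv : s ∣ v ^ j)
    (h : u.length + v.length ≤ s.length) : Commute u v := by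
  have aux : ∀ {t : FreeMonoid A} {i : ℕ}, s ∣ t ^ i → t.length ≤ s.length → t ∣ s := by
    intro t i ht hl
    obtain rfl | hi := Nat.eq_zero_or_pos i
    · have : t = 1 := by
        obtain ⟨r, hr⟩ := ht
        have := congrArg length hr
        rw [pow_zero, length_mul, length_one] at this
        exact length_eq_zero.mp (by omega)
      simp [this]
    · exact dvd_of_dvd_of_length_le (dvd_pow_self t hi.ne') ht hl
  exact eq_of_dvd_of_length_eq (mul_dvd_of_dvd_pow hu (aux hv (by omega)) h)
    (mul_dvd_of_dvd_pow hv (aux hu (by omega)) (by omega))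
    (by rw [length_mul, length_mul, add_comm])

theorem commute_of_pow_left {x y : FreeMonoid A} {l : ℕ} (hl : l ≠ 0) (h : Commute (x ^ l) y) :
    Commute x y := by
  obtain hx | hx := Nat.eq_zero_or_pos x.length
  · rw [length_eq_zero.mp hx]; exact Commute.one_left y
  obtain hy | hy := Nat.eq_zero_or_pos y.length
  · rw [length_eq_zero.mp hy]; exact Commute.one_right x
  have h1 : (x ^ l) ^ (2 * y.length) = y ^ (2 * (l * x.length)) := by
    refine eq_of_dvd_of_length_eq (Dvd.intro _ rfl)
      (Dvd.intro _ (h.pow_pow (2 * y.length) (2 * (l * x.length))).symm) ?_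
    simp only [length_pow]; ring
  rw [← pow_mul] at h1
  refine commute_of_dvd_pow dvd_rfl (Dvd.intro 1 (by rw [mul_one, h1])) ?_
  rw [length_pow]
  have : 1 ≤ l := Nat.pos_of_ne_zero hl
  have h2 : x.length + y.length ≤ 2 * (x.length * y.length) := by nlinarith
  nlinarith [Nat.mul_le_mul this (le_refl (x.length * y.length))]

theorem exists_eq_pow_of_pow_mul_eq (s z w : FreeMonoid A) (m : ℕ) (h : z ^ m * s = s * w) :
    ∃ z', w = z' ^ m := by
  induction s using FreeMonoid.inductionOn' generalizing z with
  | one => exact ⟨z, by simpa using h.symm⟩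
  | of_mul c s ih =>
    have triv : z ^ m = 1 → ∃ z', w = z' ^ m := fun hz => by
      rw [hz, one_mul] at h
      exact ⟨1, by simpa using h.symm⟩
    obtain _ | m := m
    · exact triv (pow_zero z)
    cases z using FreeMonoid.casesOn with
    | one => exact triv (one_pow _)
    | of_mul d z =>
      have hcd : d = c := by
        have := congrArg toList h
        rw [pow_succ'] at this
        simp only [mul_assoc, toList_of_mul] at this
        exact (List.cons.inj this).1
      subst hcd
      refine ih (z * of d) ?_
      rw [← mul_assoc, mul_pow_mul, mul_assoc, mul_assoc] at h
      exact mul_left_cancel h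

theorem dvd_or_dvd_or_exists_mismatch (x y : FreeMonoid A) :
    x ∣ y ∨ y ∣ x ∨ ∃ s a b x' y', a ≠ b ∧ x = s * (of a * x') ∧ y = s * (of b * y') := by
  induction x using FreeMonoid.inductionOn' generalizing y with
  | one => exact Or.inl (one_dvd y)
  | of_mul a x ih =>
    cases y using FreeMonoid.casesOn with
    | one => exact Or.inr (Or.inl (one_dvd _))
    | of_mul b y =>
      by_cases hab : a = b
      · subst hab
        rcases ih y with h | h | ⟨s, c, d, x', y', hcd, rfl, rfl⟩
        · exact Or.inl (mul_dvd_mul_left _ h)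
        · exact Or.inr (Or.inl (mul_dvd_mul_left _ h))
        · exact Or.inr (Or.inr ⟨of a * s, c, d, x', y', hcd, by simp [mul_assoc],
            by simp [mul_assoc]⟩)
      · exact Or.inr (Or.inr ⟨1, a, b, x, y, hab, by simp, by simp⟩)

/-- Two noncommuting words are simultaneously conjugate to words with distinct first letters. -/
theorem exists_conj_mismatch (x y : FreeMonoid A) (h : x * y ≠ y * x) :
    ∃ s a b x' y', a ≠ b ∧ x * s = s * (of a * x') ∧ y * s = s * (of b * y') := by
  induction hN : x.length + y.length using Nat.strong_induction_on generalizing x y with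
  | _ N ih =>
    have key : ∀ x y : FreeMonoid A, x * y ≠ y * x → x.length + y.length = N → x ∣ y →
        ∃ s a b x' y', a ≠ b ∧ x * s = s * (of a * x') ∧ y * s = s * (of b * y') := by
      rintro x _ h hN ⟨t, rfl⟩
      have hx : 0 < x.length := Nat.pos_of_ne_zero fun h0 => by
        simp [length_eq_zero.mp h0] at h
      obtain ⟨s, a, b, x', y', hab, hx', hy'⟩ := ih (x.length + t.length)
        (by rw [length_mul] at hN; omega) x t (fun hc => h (by rw [mul_assoc, ← hc])) rfl
      refine ⟨x * s, a, b, x', y' * (of a * x'), hab, ?_, ?_⟩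
      · rw [mul_assoc x s, ← hx']
      · calc x * t * (x * s) = x * (t * s) * (of a * x') := by
              rw [hx']; simp only [mul_assoc]
          _ = x * s * (of b * (y' * (of a * x'))) := by rw [hy']; simp only [mul_assoc]
    rcases dvd_or_dvd_or_exists_mismatch x y with hd | hd | ⟨s, a, b, x', y', hab, rfl, rfl⟩
    · exact key x y h hN hd
    · obtain ⟨s, a, b, x', y', hab, hx, hy⟩ := key y x h.symm (by omega) hd
      exact ⟨s, b, a, y', x', hab.symm, hy, hx⟩
    · exact ⟨s, a, b, x' * s, y' * s, hab, by simp only [mul_assoc], by simp only [mul_assoc]⟩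

theorem exists_lift_conj_mismatch (f : Bool → FreeMonoid A)
    (h : f false * f true ≠ f true * f false) :
    ∃ (s : FreeMonoid A) (g : Bool → FreeMonoid A) (a b : A), a ≠ b ∧
      (g false).toList[0]? = some a ∧ (g true).toList[0]? = some b ∧
      ∀ ws, lift f ws * s = s * lift g ws := by
  obtain ⟨s, a, b, x', y', hab, hx, hy⟩ := exists_conj_mismatch _ _ h
  refine ⟨s, fun c => bif c then of b * y' else of a * x', a, b, hab, rfl, rfl, fun ws => ?_⟩
  induction ws using FreeMonoid.inductionOn' with
  | one => simp
  | of_mul c ws ih =>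
    rw [map_mul, mul_assoc, ih, ← mul_assoc, map_mul, ← mul_assoc]
    cases c <;> simp [hx, hy]

theorem lift_injective_of_mismatch (f : Bool → FreeMonoid A) {a b : A} (hab : a ≠ b)
    (ha : (f false).toList[0]? = some a) (hb : (f true).toList[0]? = some b) :
    Function.Injective (lift f) := by
  have hne : ∀ c, f c ≠ 1 := by
    intro c hc
    cases c <;> simp [hc] at ha hb
  have hhead : ∀ c v, (f c * v).toList[0]? = some (bif c then b else a) := by
    intro c v
    have hpos : 0 < (f c).toList.length := List.length_pos_iff.mpr (hne c)
    rw [toList_mul, List.getElem?_append_left hpos]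
    cases c
    · exact ha
    · exact hb
  intro u
  induction u using FreeMonoid.inductionOn' with
  | one =>
    intro v hv
    cases v using FreeMonoid.casesOn with
    | one => rfl
    | of_mul d v =>
      have := hhead d (lift f v)
      rw [map_one, map_mul, lift_eval_of] at hv
      simp [← hv] at this
  | of_mul c u ih =>
    intro v hv
    cases v using FreeMonoid.casesOn with
    | one =>
      have := hhead c (lift f u)
      rw [map_one, map_mul, lift_eval_of] at hv
      simp [hv] at this
    | of_mul d v =>
      simp only [map_mul, lift_eval_of] at hv
      have h1 := hhead c (lift f u)
      rw [hv, hhead d] at h1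
      have hcd : c = d := by cases c <;> cases d <;> simp_all
      subst hcd
      rw [ih (mul_left_cancel hv)]

theorem lift_injective (f : Bool → FreeMonoid A) (h : f false * f true ≠ f true * f false) :
    Function.Injective (lift f) := by
  obtain ⟨s, g, a, b, hab, ha, hb, hs⟩ := exists_lift_conj_mismatch f h
  refine fun u v huv => lift_injective_of_mismatch g hab ha hb (mul_left_cancel (a := s) ?_)
  rw [← hs, ← hs, huv]

theorem exists_count_le_one_of_mismatch (f : Bool → FreeMonoid A) {a b : A} (hab : a ≠ b)
    (ha : (f false).toList[0]? = some a) (hb : (f true).toList[0]? = some b)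
    (ws : FreeMonoid Bool) (hws : ∀ v k, ws = v ^ k → k = 1) (z : FreeMonoid A) (m : ℕ)
    (hm : 2 ≤ m) (h : lift f ws = z ^ m) : ∃ c, ws.toList.count c ≤ 1 := by
  by_contra! hc
  obtain ⟨_, hlt⟩ := exists_linearOrder_lt hab
  have hws1 : ws ≠ 1 := fun h1 => by simpa using hws 1 0 (by simpa using h1)
  have hL : 0 < ws.length := Nat.pos_of_ne_zero fun h0 => hws1 (length_eq_zero.mp h0)
  have hz : 0 < z.length := Nat.pos_of_ne_zero fun h0 => hws1
    (lift_injective_of_mismatch f hab ha hb (by rw [h, length_eq_zero.mp h0, one_pow, map_one]))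
  set L := ws.length with hLdef
  set n := z.length with hn
  let w : ℕ → Bool := fun i => ws.toList.getD (i % L) false
  have hwlt : ∀ i < L, ws.toList[i]? = some (w i) := fun i hi => by
    have := getElem?_toList_pow ws false 1 i (by simpa using hi)
    rwa [pow_one] at this
  let u : ℕ → FreeMonoid Bool := fun i => ofList ((List.range i).map w)
  let W : ℕ → A := fun p => z.toList.getD (p % n) a
  let T : ℕ → ℕ := fun i => (lift f (u i)).length
  have hu : ∀ i, u (i + 1) = u i * of (w i) := fun i => by
    simp only [u, List.range_succ, List.map_append, ofList_append]; rfl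
  have huL : u L = ws := by
    refine toList.injective (List.ext_getElem? fun i => ?_)
    simp only [u, toList_ofList, List.getElem?_map]
    by_cases hi : i < L
    · rw [hwlt i hi]; simp [hi]
    · rw [List.getElem?_eq_none (by simpa using hi), List.getElem?_eq_none (not_lt.mp hi)]; rfl
  have hupow : ∀ d, Function.Periodic w d → ∀ k, u (d * k) = u d ^ k := by
    intro d hd k
    have hadd : ∀ i k, w (d * k + i) = w i := fun i k => by
      rw [add_comm, mul_comm]; simpa using hd.nat_mul k i
    induction k with
    | zero => simp [u]
    | succ k ih =>
      have : ∀ i, u (d * k + i) = u (d * k) * u i := by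
        intro i
        induction i with
        | zero => simp [u]
        | succ i ih => rw [← add_assoc, hu, ih, hadd, hu, mul_assoc]
      rw [Nat.mul_succ, this, ih, pow_succ]
  have hwL : Function.Periodic w L := fun i => by simp [w]
  have hT : ∀ i, T (i + 1) = T i + (f (w i)).length := fun i => by
    simp only [T, hu, map_mul, lift_eval_of, length_mul]
  have hTL : ∀ i, T (i + L) = T i + m * n := by
    intro i
    induction i with
    | zero =>
      have h0 : T 0 = 0 := by simp [T, u]
      rw [zero_add, h0, zero_add]
      simp only [T, huL, h, length_pow, hn]
    | succ i ih =>
      rw [show i + 1 + L = i + L + 1 by ring, hT, hwL, ih, hT]; ring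
  have hWn : Function.Periodic W n := fun p => by simp [W]
  have hdvd : ∀ i j, u i ∣ u (i + j) := by
    intro i j
    induction j with
    | zero => exact dvd_rfl
    | succ j ih => exact ih.trans ⟨_, hu (i + j)⟩
  have hW : ∀ i o, o < (f (w i)).toList.length →
      (f (w i)).toList[o]? = some (W (T i + o)) := by
    intro i o ho
    have h1 : u (i + 1) ∣ u (L * (i + 1)) := by
      obtain ⟨r, hr⟩ := Nat.exists_eq_add_of_le (Nat.le_mul_of_pos_left (i + 1) hL)
      rw [hr]
      exact hdvd _ _
    rw [hupow L hwL, huL] at h1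
    obtain ⟨r, hr⟩ := h1
    replace hr := congrArg (lift f) hr
    rw [map_pow, h, ← pow_mul, hu, map_mul, map_mul, lift_eval_of] at hr
    have hlen := congrArg length hr
    rw [length_pow, length_mul, length_mul] at hlen
    have hTi : (lift f (u i)).length = T i := rfl
    have h2 := getElem?_toList_pow z a (m * (i + 1)) (T i + o) (by
      have : o < (f (w i)).length := ho
      omega)
    rw [hr, toList_mul, toList_mul, List.getElem?_append_left,
      List.getElem?_append_right (Nat.le_add_right (T i) o)] at h2
    · change (f (w i)).toList[T i + o - T i]? = _ at h2
      rwa [Nat.add_sub_cancel_left] at h2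
    · rw [List.length_append]
      exact Nat.add_lt_add_left ho _
  have hprim : ∀ i e, (∀ k, w (i + k) = w (i + e + k)) → L ∣ e := by
    intro i e hie
    have he : Function.Periodic w e := fun k => by
      have h1 : ∀ k, w (k + L * i) = w k := fun k => by
        rw [mul_comm]; simpa using hwL.nat_mul i k
      have hle : i ≤ L * i := Nat.le_mul_of_pos_left i hL
      have h2 := hie (k + (L * i - i))
      rw [show i + (k + (L * i - i)) = k + L * i by omega,
        show i + e + (k + (L * i - i)) = k + e + L * i by omega, h1, h1] at h2
      exact h2.symm
    by_contra hne
    have hg : Nat.gcd e L < L := lt_of_le_of_ne (Nat.gcd_le_right _ hL)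
      fun hg => hne (hg ▸ Nat.gcd_dvd_left e L)
    obtain ⟨r, -, hr⟩ := Nat.exists_mul_mod_eq_gcd hg
    have hgper : Function.Periodic w (Nat.gcd e L) := fun k => by
      have h3 : w (k + e * r) = w k := by
        rw [mul_comm]; simpa using he.nat_mul r k
      rw [← hr, ← h3]
      simp only [w, Nat.add_mod_mod]
    obtain ⟨q, hq⟩ := Nat.gcd_dvd_right e L
    have h4 := hupow _ hgper q
    rw [← hq, huL] at h4
    have h5 := hws _ _ h4
    rw [h5, mul_one] at hq
    omega
  have hprim' : ∀ i j, (∀ k, w (i + k) = w (j + k)) → i ≡ j [MOD L] := by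
    intro i j hij
    rcases le_total i j with hle | hle
    · obtain ⟨e, rfl⟩ := Nat.exists_eq_add_of_le hle
      exact (Nat.modEq_iff_dvd' hle).mpr (by simpa using hprim i e hij)
    · obtain ⟨e, rfl⟩ := Nat.exists_eq_add_of_le hle
      exact ((Nat.modEq_iff_dvd' hle).mpr
        (by simpa using hprim j e fun k => (hij k).symm)).symm
  have htwo : ∀ c, ∃ i j, i < j ∧ j < L ∧ w i = c ∧ w j = c := by
    intro c
    obtain ⟨i, j, hij, hi, hj⟩ := List.duplicate_iff_exists_distinct_get.mp
      (List.duplicate_iff_two_le_count.mpr (hc c))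
    have h1 := hwlt i i.2
    have h2 := hwlt j j.2
    rw [List.getElem?_eq_getElem i.2, Option.some_inj] at h1
    rw [List.getElem?_eq_getElem j.2, Option.some_inj] at h2
    exact ⟨i, j, hij, j.2, h1.symm.trans hi.symm, h2.symm.trans hj.symm⟩
  obtain ⟨c, hcu⟩ := exists_letter_unique_occurrence (fun c => (f c).toList) w W T n L a b hlt
    ha hb hT hW hz hWn hL hwL
    (fun i => by rw [hTL]; exact Nat.add_le_add_left (Nat.mul_le_mul_right n hm) _)
    (fun i k => by
      rw [hTL, show T i + m * n + k = T i + k + m * n by ring]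
      simpa using hWn.nat_mul m (T i + k))
    hprim' ((htwo false).imp fun _ ⟨_, _, _, h, _⟩ => h)
    ((htwo true).imp fun _ ⟨_, _, _, h, _⟩ => h)
  obtain ⟨i, j, hij, hj, hwi, hwj⟩ := htwo c
  have := hcu i j hwi hwj
  rw [Nat.ModEq, Nat.mod_eq_of_lt (hij.trans hj), Nat.mod_eq_of_lt hj] at this
  omega

/-- If a primitive word in two noncommuting words is a proper power over the alphabet, then one of
the two words occurs in it at most once. -/
theorem exists_count_le_one (f : Bool → FreeMonoid A) (hf : f false * f true ≠ f true * f false)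
    (ws : FreeMonoid Bool) (hws : ∀ v k, ws = v ^ k → k = 1)
    (h : IsImprimitiveWord (lift f ws)) : ∃ c, ws.toList.count c ≤ 1 := by
  obtain ⟨s, g, a, b, hab, ha, hb, hs⟩ := exists_lift_conj_mismatch f hf
  obtain ⟨z, m, hm, hz⟩ := h
  obtain ⟨z', hz'⟩ := exists_eq_pow_of_pow_mul_eq s z _ m (by rw [← hz, hs])
  exact exists_count_le_one_of_mismatch g hab ha hb ws hws z' m hm hz'

theorem isImprimitiveWord_mul_comm {u v : FreeMonoid A} (h : IsImprimitiveWord (u * v)) :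
    IsImprimitiveWord (v * u) := by
  obtain ⟨z, m, hm, hz⟩ := h
  obtain ⟨z', hz'⟩ := exists_eq_pow_of_pow_mul_eq u z (v * u) m (by rw [← hz, mul_assoc])
  exact ⟨z', m, hm, hz'⟩

theorem eq_one_of_pow_mul_pow_eq_pow {p j k : ℕ} (hp : p ≠ 0) (hj : j ≠ 0) (v : FreeMonoid Bool)
    (h : of false ^ p * of true ^ j = v ^ k) : k = 1 := by
  have htl : ∀ (c : Bool) i, (of c ^ i).toList = List.replicate i c := fun c i => by
    induction i with
    | zero => rfl
    | succ i ih => rw [pow_succ', toList_of_mul, ih]; rfl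
  have hsort : (v ^ k).toList.Pairwise (· ≤ ·) := by
    rw [← h, toList_mul, htl, htl, List.pairwise_append]
    simp [List.pairwise_replicate]
  have hmem : ∀ c, c ∈ v.toList := fun c => by
    have : 0 < (v ^ k).toList.count c := by
      rw [← h, toList_mul, htl, htl]
      cases c <;> simp <;> omega
    rw [count_toList_pow] at this
    exact List.count_pos_iff.mp (Nat.pos_of_mul_pos_left this)
  rcases k with _ | _ | k
  · have := congrArg length h
    simp [length_mul, length_pow, hp, hj] at this
  · rfl
  · rw [pow_succ, pow_succ, mul_assoc, toList_mul, List.pairwise_append, toList_mul,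
      List.pairwise_append] at hsort
    exact absurd (hsort.2.1.2.2 true (hmem true) false (hmem false)) (by decide)

theorem commute_of_mul_pow_eq_pow_of_lt {x y u v : FreeMonoid A} {k l p q : ℕ} (hk : 1 ≤ k)
    (hkl : k < l) (hp : 2 ≤ p) (hq : 2 ≤ q) (hu : x * y ^ k = u ^ p) (hv : x * y ^ l = v ^ q) :
    Commute x y := by
  obtain ⟨j, rfl⟩ := Nat.exists_eq_add_of_lt hkl
  obtain rfl | hj := Nat.eq_zero_or_pos j
  · obtain ⟨u, hu⟩ := exists_eq_pow_of_pow_mul_eq x u (y ^ k * x) p (by rw [← hu, mul_assoc])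
    obtain ⟨v, hv⟩ := exists_eq_pow_of_pow_mul_eq (x * y) v (y ^ k * (x * y)) q
      (by rw [← hv, add_zero, pow_succ']; simp only [mul_assoc])
    have hlu := congrArg length hu
    have hlv := congrArg length hv
    simp only [length_mul, length_pow] at hlu hlv
    have h1 : y ^ k * x * y ^ k ∣ u ^ (p * 2) :=
      ⟨x, by rw [pow_mul, ← hu, sq, mul_assoc, mul_assoc, mul_assoc]⟩
    have h2 : y ^ k * x * y ^ k ∣ v ^ (q * 2) := ⟨y * x * y, by
      rw [pow_mul, ← hv, sq]
      simp only [mul_assoc]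
      rw [← mul_assoc y (y ^ k), ← pow_succ', pow_succ]
      simp only [mul_assoc]⟩
    have h3 := commute_of_dvd_pow h1 h2 (by
      simp only [length_mul, length_pow]
      nlinarith [Nat.mul_le_mul_right u.length hp, Nat.mul_le_mul_right v.length hq,
        Nat.mul_le_mul_right y.length hk])
    have h4 := (h3.pow_pow p q).eq
    rw [← hu, ← hv] at h4
    simp only [mul_assoc] at h4
    have h5 := mul_left_cancel (mul_left_cancel h4)
    rw [← mul_assoc y, ← pow_succ', pow_succ, mul_assoc] at h5
    exact mul_left_cancel h5
  · by_contra hxy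
    rw [add_assoc, pow_add, ← mul_assoc, hu] at hv
    have huy : u * y ≠ y * u := fun hc => hxy <| by
      have h1 : Commute (u ^ p) y := Commute.pow_left hc p
      rw [← hu] at h1
      have h2 := h1.eq
      rw [mul_assoc, ← pow_succ, pow_succ', ← mul_assoc, ← mul_assoc] at h2
      exact mul_right_cancel h2
    obtain ⟨c, hc⟩ := exists_count_le_one (fun c => bif c then y else u) huy
      (of false ^ p * of true ^ (j + 1))
      (fun v k => eq_one_of_pow_mul_pow_eq_pow (by omega) (by omega) v)
      ⟨v, q, hq, by simpa using hv⟩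
    rw [toList_mul, List.count_append, count_toList_pow, count_toList_pow] at hc
    cases c <;> simp at hc <;> omega

theorem exists_of_mul_eq_mul {s r x : FreeMonoid A} (hs : s ≠ 1) (h : s * x = x * r) :
    ∃ a b n, s = a * b ∧ r = b * a ∧ x = (a * b) ^ n * a := by
  induction hN : x.length using Nat.strong_induction_on generalizing x with
  | _ N ih =>
    rcases le_total x.length s.length with hl | hl
    · obtain ⟨b, rfl⟩ := dvd_of_dvd_of_length_le (Dvd.intro r rfl) (Dvd.intro x h) hl
      exact ⟨x, b, 0, rfl, (mul_left_cancel (by rw [← h, mul_assoc])), by simp⟩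
    · obtain ⟨x, rfl⟩ := dvd_of_dvd_of_length_le (Dvd.intro x h) (Dvd.intro r rfl) hl
      have hs' : 0 < s.length := Nat.pos_of_ne_zero fun h0 => hs (length_eq_zero.mp h0)
      rw [mul_assoc s x] at h
      obtain ⟨a, b, n, rfl, rfl, rfl⟩ := ih x.length (by rw [length_mul] at hN; omega)
        (mul_left_cancel h) rfl
      exact ⟨a, b, n + 1, rfl, rfl, by simp only [pow_succ', mul_assoc]⟩

theorem commute_of_pow_mul_eq_pow {x y u v : FreeMonoid A} {k l p q : ℕ} (hk : 1 ≤ k)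
    (hl : 2 ≤ l) (hp : 2 ≤ p) (hq : 2 ≤ q) (hxy : y.length ≤ x.length)
    (hu : x * y ^ k = u ^ p) (hv : x ^ l * y = v ^ q) : Commute x y := by
  have hlen := congrArg length hv
  simp only [length_mul, length_pow] at hlen
  by_cases hlq : 3 ≤ l ∨ 3 ≤ q
  · have h1 : Commute x v := commute_of_dvd_pow (s := x ^ l) dvd_rfl (Dvd.intro y hv) (by
      rw [length_pow]
      rcases hlq with h3 | h3
      · nlinarith [Nat.mul_le_mul_right x.length h3, Nat.mul_le_mul_right v.length hq]
      · nlinarith [Nat.mul_le_mul_right x.length hl, Nat.mul_le_mul_right v.length h3])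
    have h2 := (h1.pow_pow l q).eq
    rw [← hv, mul_assoc (x ^ l) y] at h2
    exact commute_of_pow_left (by omega) (mul_left_cancel h2)
  · obtain rfl : l = 2 := by omega
    obtain rfl : q = 2 := by omega
    rw [sq, sq, mul_assoc] at hv
    obtain ⟨s, rfl⟩ := dvd_of_dvd_of_length_le (Dvd.intro _ hv) (Dvd.intro v rfl) (by omega)
    rw [mul_assoc x s] at hv
    replace hv := mul_left_cancel hv
    obtain ⟨r, hr⟩ : x ∣ s * x := dvd_of_dvd_of_length_le (c := x * y) (Dvd.intro y rfl)
      (Dvd.intro s (by rw [hv, mul_assoc])) (by rw [length_mul]; omega)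
    rw [← mul_assoc, hr, mul_assoc] at hv
    obtain rfl := mul_left_cancel hv
    by_cases hs : s = 1
    · subst hs
      rw [one_mul] at hr
      have : r = 1 := by simpa using hr.symm
      simp [this]
    obtain ⟨a, b, n, rfl, rfl, rfl⟩ := exists_of_mul_eq_mul hs hr
    by_cases hab : Commute a b
    · have h1 : Commute a (b * a * (a * b)) :=
        (hab.mul_right (Commute.refl a)).mul_right ((Commute.refl a).mul_right hab)
      have h2 : Commute b (b * a * (a * b)) :=
        ((Commute.refl b).mul_right hab.symm).mul_right (hab.symm.mul_right (Commute.refl b))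
      exact ((h1.mul_left h2).pow_left n).mul_left h1
    · exfalso
      have hcnt : ∀ c, ((of false * of true) ^ n * of false *
          (of true * of false * (of false * of true)) ^ k).toList.count c =
            n + (if c then 0 else 1) + 2 * k := fun c => by
        simp only [toList_mul, List.count_append, count_toList_pow, toList_of]
        cases c <;> simp <;> ring
      obtain ⟨c, hc⟩ := exists_count_le_one (fun c => bif c then b else a) hab
        ((of false * of true) ^ n * of false * (of true * of false * (of false * of true)) ^ k)
        (fun v i hvi => by
          have h0 := hcnt false
          have h1 := hcnt true
          rw [hvi, count_toList_pow] at h0 h1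
          simp only [Bool.false_eq_true, if_false, if_true] at h0 h1
          have : i ∣ 1 := (Nat.dvd_add_right (Dvd.intro _ h1)).mp
            (Dvd.intro (List.count false v.toList) (by rw [h0]; ring))
          exact Nat.dvd_one.mp this)
        ⟨u, p, hp, by simpa using hu⟩
      rw [hcnt] at hc
      omega

theorem ofList_eq_pow_of_count_eq_zero {c : Bool} (l : List Bool) (hl : l.count c = 0) :
    ofList l = of (!c) ^ l.length := by
  induction l with
  | nil => rfl
  | cons d l ih =>
    have hd : d = !c := by cases c <;> cases d <;> simp_all
    subst hd
    rw [ofList_cons, List.length_cons, pow_succ', ih (by simpa using hl)]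

theorem exists_eq_of_count_le_one {c : Bool} {ws : FreeMonoid Bool}
    (hws : ∀ v k, ws = v ^ k → k = 1) (hlen : ws.length ≠ 1) (h : ws.toList.count c ≤ 1) :
    ∃ k i, 1 ≤ k ∧ i ≤ k ∧ ws = of (!c) ^ i * of c * of (!c) ^ (k - i) := by
  have hc : ws.toList.count c ≠ 0 := fun h0 =>
    hlen (hws _ _ (ofList_eq_pow_of_count_eq_zero ws.toList h0))
  obtain ⟨l, r, hlr, -⟩ := List.eq_append_cons_of_mem (a := c) (xs := ws.toList)
    (List.count_pos_iff.mp (by omega))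
  have hlen' : ws.length = l.length + (r.length + 1) := by
    rw [length, hlr, List.length_append, List.length_cons]
  rw [hlr, List.count_append, List.count_cons_self] at h
  refine ⟨l.length + r.length, l.length, by omega, by omega, ?_⟩
  rw [Nat.add_sub_cancel_left, ← ofList_eq_pow_of_count_eq_zero l (by omega),
    ← ofList_eq_pow_of_count_eq_zero r (by omega), mul_assoc, ← ofList_cons, ← ofList_append,
    ← hlr, ofList_toList]

theorem isImprimitiveWord_pow_mul_mul_pow_iff {x y : FreeMonoid A} {i k : ℕ} (hi : i ≤ k) :
    IsImprimitiveWord (x ^ i * y * x ^ (k - i)) ↔ IsImprimitiveWord (y * x ^ k) := by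
  have hk : y * x ^ k = y * x ^ (k - i) * x ^ i := by
    rw [mul_assoc, ← pow_add, Nat.sub_add_cancel hi]
  rw [hk, mul_assoc]
  exact ⟨isImprimitiveWord_mul_comm, isImprimitiveWord_mul_comm⟩

theorem eq_of_isImprimitiveWord_mul_pow {x y : FreeMonoid A} (h : x * y ≠ y * x) {k l : ℕ}
    (hk : 1 ≤ k) (hl : 1 ≤ l) (hxk : IsImprimitiveWord (x * y ^ k))
    (hxl : IsImprimitiveWord (x * y ^ l)) : k = l := by
  obtain ⟨u, p, hp, hu⟩ := hxk
  obtain ⟨v, q, hq, hv⟩ := hxl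
  by_contra hne
  rcases lt_or_gt_of_ne hne with hlt | hlt
  · exact h (commute_of_mul_pow_eq_pow_of_lt hk hlt hp hq hu hv)
  · exact h (commute_of_mul_pow_eq_pow_of_lt hl hlt hq hp hv hu)

theorem eq_one_of_isImprimitiveWord_mul_pow {x y : FreeMonoid A} (h : x * y ≠ y * x) {k l : ℕ}
    (hk : 1 ≤ k) (hl : 1 ≤ l) (hxy : IsImprimitiveWord (x * y ^ k))
    (hyx : IsImprimitiveWord (y * x ^ l)) : k = 1 ∧ l = 1 := by
  obtain rfl | hk2 : k = 1 ∨ 2 ≤ k := by omega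
  · rw [pow_one] at hxy
    exact ⟨rfl, eq_of_isImprimitiveWord_mul_pow h.symm hl le_rfl hyx
      (by simpa using isImprimitiveWord_mul_comm hxy)⟩
  obtain rfl | hl2 : l = 1 ∨ 2 ≤ l := by omega
  · rw [pow_one] at hyx
    exact ⟨eq_of_isImprimitiveWord_mul_pow h hk le_rfl hxy
      (by simpa using isImprimitiveWord_mul_comm hyx), rfl⟩
  exfalso
  rcases le_total y.length x.length with hle | hle
  · obtain ⟨u, p, hp, hu⟩ := hxy
    obtain ⟨v, q, hq, hv⟩ := isImprimitiveWord_mul_comm hyx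
    exact h (commute_of_pow_mul_eq_pow hk hl2 hp hq hle hu hv)
  · obtain ⟨u, p, hp, hu⟩ := hyx
    obtain ⟨v, q, hq, hv⟩ := isImprimitiveWord_mul_comm hxy
    exact h.symm (commute_of_pow_mul_eq_pow hl hk2 hp hq hle hu hv)

theorem primitive_imprimitive_iff (f : Bool → FreeMonoid A)
    (h : f false * f true ≠ f true * f false) (w : FreeMonoid A) :
    (w ∈ MonoidHom.mrange (lift f) ∧ w ≠ f false ∧ w ≠ f true ∧ w ≠ 1 ∧
      (∀ v ∈ MonoidHom.mrange (lift f), ∀ i : ℕ, 1 ≤ i → w = v ^ i → w = v) ∧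
      IsImprimitiveWord w) ↔
    ∃ c k i, 1 ≤ k ∧ i ≤ k ∧ IsImprimitiveWord (f c * f (!c) ^ k) ∧
      w = f (!c) ^ i * f c * f (!c) ^ (k - i) := by
  have hinj := lift_injective f h
  constructor
  · rintro ⟨⟨ws, rfl⟩, h0, h1, hne, hprim, himp⟩
    have hws1 : ws ≠ 1 := fun hc => hne (by rw [hc, map_one])
    have hws : ∀ v k, ws = v ^ k → k = 1 := by
      intro v k hv
      have hk : k ≠ 0 := fun hk => hws1 (by rw [hv, hk, pow_zero])
      have hwv := hinj (hprim (lift f v) ⟨v, rfl⟩ k (by omega) (by rw [hv, map_pow]))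
      have hlen := congrArg length hv
      rw [length_pow, ← hwv] at hlen
      have hpos : 0 < ws.length := Nat.pos_of_ne_zero fun hc => hws1 (length_eq_zero.mp hc)
      exact (Nat.mul_eq_right hpos.ne').mp hlen.symm
    obtain ⟨c, hc⟩ := exists_count_le_one f h ws hws himp
    obtain ⟨k, i, hk, hi, rfl⟩ := exists_eq_of_count_le_one hws (fun hlen => by
      obtain ⟨d, rfl⟩ := length_eq_one.mp hlen
      cases d
      · exact h0 rfl
      · exact h1 rfl) hc
    have heq : lift f (of (!c) ^ i * of c * of (!c) ^ (k - i)) =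
      f (!c) ^ i * f c * f (!c) ^ (k - i) := by simp
    rw [heq] at himp
    exact ⟨c, k, i, hk, hi, (isImprimitiveWord_pow_mul_mul_pow_iff hi).mp himp, heq⟩
  · rintro ⟨c, k, i, hk, hi, himp, rfl⟩
    set ws := of (!c) ^ i * of c * of (!c) ^ (k - i)
    have heq : f (!c) ^ i * f c * f (!c) ^ (k - i) = lift f ws := by simp [ws]
    have hlen : ws.length = k + 1 := by
      simp only [ws, length_mul, length_pow, length_of]; omega
    have hof : ∀ d, lift f ws ≠ f d := fun d hd => by
      have := congrArg length (hinj (hd.trans (lift_eval_of f d).symm))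
      rw [hlen, length_of] at this
      omega
    have himp' := (isImprimitiveWord_pow_mul_mul_pow_iff hi).mpr himp
    rw [heq] at himp' ⊢
    refine ⟨⟨ws, rfl⟩, hof _, hof _, fun hc => ?_, ?_, himp'⟩
    · have := congrArg length (hinj (hc.trans (map_one _).symm))
      rw [hlen, length_one] at this
      omega
    · rintro _ ⟨v, rfl⟩ j - hj
      rw [← map_pow] at hj
      have hcount := congrArg (fun u => u.toList.count c) (hinj hj)
      simp only [ws, toList_mul, List.count_append, count_toList_pow, toList_of] at hcount
      have hj1 : j = 1 := by
        refine Nat.dvd_one.mp ⟨v.toList.count c, ?_⟩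
        rw [← hcount]
        cases c <;> simp
      rw [hj, hj1, pow_one]

end FreeMonoid

/-- Let `x, y` be non-commuting words and let `C` be the set of all `X`-primitive
but imprimitive words of `X* \ {x, y, 1}` where `X = {x, y}`. Then `C` is empty or
equals `{xⁱyx^(k-i) : 0 ≤ i ≤ k}` or `{yⁱxy^(k-i) : 0 ≤ i ≤ k}` for some `k ≥ 1`. -/
theorem stmt7 {A : Type*} (x y : FreeMonoid A) (h : x * y ≠ y * x)
    (C : Set (FreeMonoid A))
    (hC : C = {w | w ∈ Submonoid.closure ({x, y} : Set (FreeMonoid A)) ∧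
      w ≠ x ∧ w ≠ y ∧ w ≠ 1 ∧
      (∀ v ∈ Submonoid.closure ({x, y} : Set (FreeMonoid A)),
        ∀ i : ℕ, 1 ≤ i → w = v ^ i → w = v) ∧
      IsImprimitiveWord w}) :
    C = ∅ ∨ ∃ k : ℕ, 1 ≤ k ∧
      (C = {w | ∃ i ≤ k, w = x ^ i * y * x ^ (k - i)} ∨
        C = {w | ∃ i ≤ k, w = y ^ i * x * y ^ (k - i)}) := by
  let f : Bool → FreeMonoid A := fun c => bif c then y else x
  have hf : f false * f true ≠ f true * f false := h
  have hcl : Submonoid.closure ({x, y} : Set (FreeMonoid A)) =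
      MonoidHom.mrange (FreeMonoid.lift f) := by
    rw [FreeMonoid.mrange_lift]
    congr 1
    ext w
    simp [f, eq_comm]
  have hmem : ∀ w, w ∈ C ↔ ∃ c k i, 1 ≤ k ∧ i ≤ k ∧ IsImprimitiveWord (f c * f (!c) ^ k) ∧
      w = f (!c) ^ i * f c * f (!c) ^ (k - i) := fun w => by
    rw [hC, hcl]
    exact FreeMonoid.primitive_imprimitive_iff f hf w
  have hne : ∀ c, f c * f (!c) ≠ f (!c) * f c := fun c => by
    cases c
    · exact hf
    · exact hf.symm
  have key : ∀ c k, 1 ≤ k → IsImprimitiveWord (f c * f (!c) ^ k) →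
      C = {w | ∃ i ≤ k, w = f (!c) ^ i * f c * f (!c) ^ (k - i)} := by
    intro c k hk himp
    ext w
    rw [hmem]
    constructor
    · rintro ⟨d, l, i, hl, hi, himp', rfl⟩
      by_cases hd : d = c
      · subst hd
        obtain rfl := FreeMonoid.eq_of_isImprimitiveWord_mul_pow (hne d) hk hl himp himp'
        exact ⟨i, hi, rfl⟩
      · obtain rfl : d = !c := by cases c <;> cases d <;> simp_all
        rw [Bool.not_not] at himp' ⊢
        obtain ⟨rfl, rfl⟩ :=
          FreeMonoid.eq_one_of_isImprimitiveWord_mul_pow (hne c) hk hl himp himp'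
        refine ⟨1 - i, by omega, ?_⟩
        obtain rfl | rfl : i = 0 ∨ i = 1 := by omega
        · simp
        · simp
    · rintro ⟨i, hi, rfl⟩
      exact ⟨c, k, i, hk, hi, himp, rfl⟩
  rcases Set.eq_empty_or_nonempty C with hempty | ⟨w, hw⟩
  · exact Or.inl hempty
  · obtain ⟨c, k, i, hk, -, himp, -⟩ := (hmem w).mp hw
    refine Or.inr ⟨k, hk, ?_⟩
    cases c
    · exact Or.inr (key false k hk himp)
    · exact Or.inl (key true k hk himp)
end

section
/- Let x, y, z be words over an alphabet A and let i, k ≥ 0, j ≥ 2, ℓ ≥ 2 be integers with i + k ≥ 2. If x^i y^j x^k = z^ℓ, then the words x, y, z pairwise commute (equivalently, all three are powers of a single common word). -/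
theorem List.append_lt_append_of_length_eq {A : Type*} [LinearOrder A] {c d : List A} (h : c < d)
    (hl : c.length = d.length) (b : List A) : c ++ b < d ++ b := by
  induction c generalizing d with
  | nil =>
    obtain rfl := List.length_eq_zero_iff.1 hl.symm
    exact absurd h (lt_irrefl _)
  | cons x c ih =>
    rcases d with _ | ⟨y, d⟩
    · simp at hl
    · rw [List.cons_lt_cons_iff] at h
      rw [List.cons_append, List.cons_append, List.cons_lt_cons_iff]
      rcases h with h | ⟨h, h'⟩
      · exact Or.inl h
      · exact Or.inr ⟨h, ih h' (by simpa using hl)⟩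

namespace FreeMonoid

variable {A : Type*}

theorem length_pow_eq (x : FreeMonoid A) (n : ℕ) : (x ^ n).length = n * x.length := by
  induction n with
  | zero => simp
  | succ n ih => rw [pow_succ, length_mul, ih]; ring

/-- Equidivisibility of the free monoid (lemma of Levi). -/
theorem exists_eq_mul_of_mul_eq_mul {a b c d : FreeMonoid A} (h : a * b = c * d)
    (hl : a.length ≤ c.length) : ∃ t, c = a * t ∧ b = t * d := by
  have h' : a.toList ++ b.toList = c.toList ++ d.toList := h
  rcases List.append_eq_append_iff.1 h' with ⟨t, h₁, h₂⟩ | ⟨t, h₁, h₂⟩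
  · exact ⟨ofList t, h₁, h₂⟩
  · have ha : a.length = c.length + t.length := by
      have := congrArg List.length h₁
      rwa [List.length_append] at this
    have ht : t = [] := List.length_eq_zero_iff.1 (by omega)
    subst ht
    have h₁' : a = c := by
      apply toList.injective
      simpa using h₁
    subst h₁'
    exact ⟨1, (mul_one a).symm, by rw [one_mul]; exact mul_left_cancel h⟩

theorem eq_and_eq_of_mul_eq_mul {a b c d : FreeMonoid A} (h : a * b = c * d)
    (hl : a.length = c.length) : a = c ∧ b = d := by
  obtain ⟨t, rfl, rfl⟩ := exists_eq_mul_of_mul_eq_mul h hl.le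
  have ht : t = 1 := length_eq_zero.1 (by rw [length_mul] at hl; omega)
  simp [ht]

theorem commute_of_commute_pow_left {x y : FreeMonoid A} {n : ℕ} (hn : n ≠ 0)
    (h : Commute (x ^ n) y) : Commute x y := by
  by_cases hx : x = 1
  · rw [hx]; exact Commute.one_left y
  by_cases hy : y = 1
  · rw [hy]; exact Commute.one_right x
  have hx' : x.length ≠ 0 := fun h => hx (length_eq_zero.1 h)
  have hy' : y.length ≠ 0 := fun h => hy (length_eq_zero.1 h)
  have key : (x ^ n) ^ y.length = y ^ (n * x.length) := by
    refine (eq_and_eq_of_mul_eq_mul (h.pow_pow y.length (n * x.length)).eq ?_).1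
    simp only [length_pow_eq]; ring
  rw [← pow_mul] at key
  have hxw : Commute x (y ^ (n * x.length)) := by
    rw [← key]; exact Commute.self_pow x _
  have hyw : Commute y (y ^ (n * x.length)) := Commute.self_pow y _
  obtain ⟨m, hm⟩ : ∃ m, n * x.length = m + 1 := Nat.exists_eq_succ_of_ne_zero (by positivity)
  obtain ⟨m', hm'⟩ : ∃ m, n * y.length = m + 1 := Nat.exists_eq_succ_of_ne_zero (by positivity)
  rw [hm, hm'] at key
  rw [hm] at hxw hyw
  have h₁ : x * y * (y ^ m * x ^ m') = y * x * (x ^ m' * y ^ m) := by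
    calc x * y * (y ^ m * x ^ m') = x * y ^ (m + 1) * x ^ m' := by
          rw [pow_succ' y]; simp only [mul_assoc]
      _ = y ^ (m + 1) * y ^ (m + 1) := by
          rw [hxw.eq, mul_assoc, ← pow_succ' x, key]
      _ = y * y ^ (m + 1) * y ^ m := by
          rw [hyw.eq, mul_assoc, ← pow_succ' y]
      _ = y * x * (x ^ m' * y ^ m) := by
          rw [← key, pow_succ' x]; simp only [mul_assoc]
  exact (eq_and_eq_of_mul_eq_mul h₁ (by simp only [length_mul]; omega)).1

/-- A rotation of a power is a power. -/
theorem exists_pow_eq_mul_swap {y : FreeMonoid A} {j : ℕ} (hj : j ≠ 0) :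
    ∀ {a b : FreeMonoid A}, a * b = y ^ j → ∃ y', y'.length = y.length ∧ b * a = y' ^ j := by
  obtain ⟨m, rfl⟩ := Nat.exists_eq_succ_of_ne_zero hj
  intro a
  induction hN : a.length using Nat.strong_induction_on generalizing a with
  | _ N ih =>
    intro b h
    rw [pow_succ'] at h
    rcases le_total a.length y.length with hl | hl
    · obtain ⟨q, rfl, rfl⟩ := exists_eq_mul_of_mul_eq_mul h hl
      refine ⟨q * a, by simp only [length_mul]; ring, ?_⟩
      rw [pow_succ, ← mul_assoc, mul_pow_mul]
    · by_cases hy : y = 1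
      · subst hy
        refine ⟨1, rfl, ?_⟩
        have := congrArg length h
        simp only [one_pow, mul_one, length_mul, length_one] at this
        rw [one_pow]
        exact length_eq_zero.1 (by rw [length_mul]; omega)
      have hy' : y.length ≠ 0 := fun h => hy (length_eq_zero.1 h)
      obtain ⟨a', rfl, ha'⟩ := exists_eq_mul_of_mul_eq_mul h.symm hl
      rw [length_mul] at hN
      obtain ⟨y', hy', h'⟩ := ih a'.length (by omega) rfl (b := b * y)
        (by rw [← mul_assoc, ← ha', ← pow_succ])
      exact ⟨y', hy', by rw [← h', mul_assoc]⟩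

/-- A weak form of the periodicity lemma. -/
theorem commute_of_mul_self_mul_eq_pow {x z w : FreeMonoid A} {l : ℕ}
    (h : x * x * w = z ^ l) (hl : z.length ≤ x.length) : Commute x z := by
  rcases l with _ | m
  · have := congrArg length h
    simp only [pow_zero, length_mul, length_one] at this
    rw [length_eq_zero.1 (show x.length = 0 by omega)]
    exact Commute.one_left z
  obtain ⟨s, hs, -⟩ := exists_eq_mul_of_mul_eq_mul (c := x) (d := x * w)
    (by rw [← pow_succ', ← h, mul_assoc]) hl
  have h₁ : x * z * (s * w * z) = z * x * (x * w) := by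
    calc x * z * (s * w * z) = x * (z * s) * w * z := by simp only [mul_assoc]
      _ = z ^ (m + 1) * z := by rw [← hs, h]
      _ = z * z ^ (m + 1) := (Commute.self_pow z _).eq.symm
      _ = z * x * (x * w) := by rw [← h]; simp only [mul_assoc]
  exact (eq_and_eq_of_mul_eq_mul h₁ (by simp only [length_mul]; omega)).1

theorem exists_eq_pow_of_commute {b c : FreeMonoid A} (h : Commute b c) :
    ∃ (t : FreeMonoid A) (m n : ℕ), b = t ^ m ∧ c = t ^ n := by
  induction hN : b.length + c.length using Nat.strong_induction_on generalizing b c with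
  | _ N ih =>
    by_cases hb : b = 1
    · exact ⟨c, 0, 1, by simp [hb]⟩
    by_cases hc : c = 1
    · exact ⟨b, 1, 0, by simp [hc]⟩
    have hb' : b.length ≠ 0 := fun h => hb (length_eq_zero.1 h)
    have hc' : c.length ≠ 0 := fun h => hc (length_eq_zero.1 h)
    rcases le_total b.length c.length with hl | hl
    · obtain ⟨s, rfl, hs⟩ := exists_eq_mul_of_mul_eq_mul h.eq hl
      rw [length_mul] at hN
      obtain ⟨t, m, n, rfl, rfl⟩ := ih (b.length + s.length) (by omega) (b := b) (c := s) hs rfl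
      exact ⟨t, m, m + n, rfl, (pow_add t m n).symm⟩
    · obtain ⟨s, rfl, hs⟩ := exists_eq_mul_of_mul_eq_mul h.eq.symm hl
      rw [length_mul] at hN
      obtain ⟨t, m, n, rfl, rfl⟩ := ih (c.length + s.length) (by omega) (b := c) (c := s) hs rfl
      exact ⟨t, m + n, m, (pow_add t m n).symm, rfl⟩

/-- A word is primitive if it is not a product of two nontrivial commuting words. -/
def IsPrimitive (z : FreeMonoid A) : Prop :=
  ∀ b c : FreeMonoid A, b * c = z → c * b = z → b = 1 ∨ c = 1

/-- A word is unbordered if none of its nontrivial proper prefixes is also a suffix. -/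
def IsUnbordered (u : FreeMonoid A) : Prop :=
  ∀ b c d : FreeMonoid A, u = b * c → u = d * b → b = 1 ∨ c = 1

theorem exists_isPrimitive_pow_eq (z : FreeMonoid A) :
    ∃ (r : FreeMonoid A) (m : ℕ), IsPrimitive r ∧ z = r ^ m := by
  induction hN : z.length using Nat.strong_induction_on generalizing z with
  | _ N ih =>
    by_cases hz : IsPrimitive z
    · exact ⟨z, 1, hz, (pow_one z).symm⟩
    simp only [IsPrimitive, not_forall, not_or] at hz
    obtain ⟨b, c, hbc, hcb, hb, hc⟩ := hz
    obtain ⟨t, m, n, rfl, rfl⟩ := exists_eq_pow_of_commute (hbc.trans hcb.symm)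
    have hm : m ≠ 0 := by rintro rfl; exact hb (pow_zero t)
    have hn : n ≠ 0 := by rintro rfl; exact hc (pow_zero t)
    have ht : t.length ≠ 0 := fun h => hb (by rw [length_eq_zero.1 h, one_pow])
    rw [← pow_add] at hbc
    have hlt : t.length < N := by
      rw [← hN, ← hbc, length_pow_eq]
      have : 2 ≤ m + n := by omega
      nlinarith [Nat.pos_of_ne_zero ht]
    obtain ⟨r, k, hr, rfl⟩ := ih _ hlt t rfl
    exact ⟨r, k * (m + n), hr, by rw [← hbc, pow_mul]⟩

/-- A lexicographically minimal rotation of a primitive word is unbordered. -/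
theorem IsPrimitive.exists_isUnbordered {z : FreeMonoid A} (hz : IsPrimitive z) :
    ∃ p q : FreeMonoid A, p * q = z ∧ IsUnbordered (q * p) := by
  let _ : LinearOrder A := IsWellOrder.linearOrder WellOrderingRel
  obtain ⟨k, -, hk⟩ := Finset.exists_min_image (Finset.range (z.length + 1))
    (fun k => z.toList.drop k ++ z.toList.take k) ⟨0, by simp⟩
  have hmin : ∀ p q : FreeMonoid A, p * q = z →
      z.toList.drop k ++ z.toList.take k ≤ (q * p).toList := by
    rintro p q rfl
    have := hk p.length (by simp [length_mul])
    have h₁ : (p * q).toList.drop p.length = q.toList := List.drop_left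
    have h₂ : (p * q).toList.take p.length = p.toList := List.take_left
    rwa [h₁, h₂] at this
  refine ⟨ofList (z.toList.take k), ofList (z.toList.drop k), List.take_append_drop k _, ?_⟩
  have hpq : ofList (z.toList.take k) * ofList (z.toList.drop k) = z :=
    List.take_append_drop k _
  set p := ofList (z.toList.take k)
  set q := ofList (z.toList.drop k)
  have hmin' : ∀ b c : FreeMonoid A, q * p = b * c → (q * p).toList ≤ (c * b).toList := by
    intro b c h
    rcases le_total q.length b.length with hl | hl
    · obtain ⟨t, rfl, ht⟩ := exists_eq_mul_of_mul_eq_mul h hl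
      rw [← mul_assoc]
      exact hmin t (c * q) (by rw [← mul_assoc, ← ht, hpq])
    · obtain ⟨t, ht, rfl⟩ := exists_eq_mul_of_mul_eq_mul h.symm hl
      rw [mul_assoc]
      exact hmin (p * b) t (by rw [mul_assoc, ← ht, hpq])
  intro b c d hbc hdb
  have hlen : c.length = d.length := by
    have := congrArg length (hbc.symm.trans hdb)
    simp only [length_mul] at this
    omega
  have hcd : c = d := by
    apply toList.injective
    refine le_antisymm (le_of_not_gt fun hlt => ?_) (le_of_not_gt fun hlt => ?_)
    · have := hmin' d b hdb
      rw [hbc] at this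
      exact absurd (List.append_left_lt hlt) (not_lt_of_ge this)
    · have := hmin' b c hbc
      rw [hdb] at this
      exact absurd (List.append_lt_append_of_length_eq hlt hlen b.toList) (not_lt_of_ge this)
  subst hcd
  obtain ⟨t, m, n, rfl, rfl⟩ := exists_eq_pow_of_commute (hbc.symm.trans hdb)
  by_cases hm : m = 0
  · exact Or.inl (by rw [hm, pow_zero])
  rw [← pow_add] at hbc
  obtain ⟨t', ht', h'⟩ := exists_pow_eq_mul_swap (by omega) hbc
  rw [hpq] at h'
  have key : ∀ k : ℕ, t' ^ k = 1 → t ^ k = 1 := fun k hk =>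
    length_eq_zero.1 (by rw [length_pow_eq, ← ht', ← length_pow_eq, hk, length_one])
  exact (hz (t' ^ m) (t' ^ n) (by rw [← pow_add, h'])
    (by rw [← pow_add, add_comm, h'])).imp (key m) (key n)

theorem IsUnbordered.length_le_of_mul_eq_pow {u x c d : FreeMonoid A} {n : ℕ}
    (hu : IsUnbordered u) (hx : x ≠ 1) (h : c * u * d = x ^ n) : u.length ≤ x.length := by
  by_contra! hlt
  rcases n with _ | m
  · have := congrArg length h
    simp only [pow_zero, length_mul, length_one] at this
    omega
  rw [mul_assoc] at h
  obtain ⟨x', hx', h'⟩ := exists_pow_eq_mul_swap m.succ_ne_zero h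
  have hx0 : x.length ≠ 0 := fun h => hx (length_eq_zero.1 h)
  have h₁ := h'
  rw [pow_succ', mul_assoc] at h₁
  obtain ⟨s, hs, hs'⟩ := exists_eq_mul_of_mul_eq_mul h₁.symm (by omega)
  have hl := congrArg length hs
  rw [length_mul] at hl
  have h₂ : s * (d * c * x') = u * (d * c) := by
    rw [← mul_assoc u, h', pow_succ, hs']
    simp only [mul_assoc]
  obtain ⟨s', hs'', -⟩ := exists_eq_mul_of_mul_eq_mul h₂ (by omega)
  have hl' := congrArg length hs''
  rw [length_mul] at hl'
  rcases hu s s' x' hs'' hs with rfl | rfl <;> simp only [length_one] at hl hl' <;> omega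

theorem commute_of_pow_mul_pow_eq_pow_of_commute {x y z : FreeMonoid A} {n j l : ℕ}
    (hj : j ≠ 0) (h : x ^ n * y ^ j = z ^ l) (hxz : Commute x z) : Commute x y := by
  have h₁ : x * (x ^ n * y ^ j) = x ^ n * y ^ j * x := by rw [h]; exact (hxz.pow_right l).eq
  have h₂ : x ^ n * (x * y ^ j) = x ^ n * (y ^ j * x) := by
    rw [← mul_assoc, ← mul_assoc, ← h₁, ← mul_assoc, (Commute.self_pow x n).eq]
  exact (commute_of_commute_pow_left hj (mul_left_cancel h₂ : x * y ^ j = y ^ j * x).symm).symm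

/-- The case of the Lyndon–Schützenberger theorem where `z` is primitive and `3 ≤ l`. -/
theorem IsPrimitive.commute_of_pow_mul_pow_eq_pow {x y z : FreeMonoid A} {n j l : ℕ}
    (hz : IsPrimitive z) (hn : 2 ≤ n) (hj : 2 ≤ j) (hl : 3 ≤ l)
    (h : x ^ n * y ^ j = z ^ l) : Commute x y := by
  by_cases hx : x = 1
  · rw [hx]; exact Commute.one_left y
  by_cases hy : y = 1
  · rw [hy]; exact Commute.one_right x
  obtain ⟨n, rfl⟩ := Nat.exists_eq_add_of_le hn
  obtain ⟨j, rfl⟩ := Nat.exists_eq_add_of_le hj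
  obtain ⟨l, rfl⟩ := Nat.exists_eq_add_of_le hl
  rcases le_or_gt z.length x.length with hxz | hxz
  · refine commute_of_pow_mul_pow_eq_pow_of_commute (by omega) h
      (commute_of_mul_self_mul_eq_pow (l := 3 + l) (w := x ^ n * y ^ (2 + j)) ?_ hxz)
    rw [← h, pow_add x, pow_two]; simp only [mul_assoc]
  rcases le_or_gt z.length y.length with hyz | hyz
  · obtain ⟨z', hz', h'⟩ := exists_pow_eq_mul_swap (by omega) h
    refine (commute_of_pow_mul_pow_eq_pow_of_commute (by omega) h'
      (commute_of_mul_self_mul_eq_pow (l := 3 + l) (w := y ^ j * x ^ (2 + n)) ?_ (hz' ▸ hyz))).symm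
    rw [← h', pow_add y, pow_two]; simp only [mul_assoc]
  exfalso
  obtain ⟨p, q, rfl, hu⟩ := hz.exists_isUnbordered
  have hlen : (q * p).length = (p * q).length := by simp only [length_mul]; ring
  have hpow : x ^ (2 + n) * y ^ (2 + j) = p * (q * p) * ((q * p) * ((q * p) ^ l * q)) := by
    rw [h, show 3 + l = l + 1 + 1 + 1 by ring, pow_succ', pow_succ', pow_succ', mul_pow_mul]
    simp only [mul_assoc]
  rcases le_total (p * (q * p)).length (x ^ (2 + n)).length with hle | hle
  · obtain ⟨t, ht, -⟩ := exists_eq_mul_of_mul_eq_mul hpow.symm hle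
    have := hu.length_le_of_mul_eq_pow hx ht.symm
    omega
  · obtain ⟨t, -, ht⟩ := exists_eq_mul_of_mul_eq_mul hpow hle
    rw [← mul_assoc] at ht
    have := hu.length_le_of_mul_eq_pow hy ht.symm
    omega

/-- The **Lyndon–Schützenberger theorem**. -/
theorem commute_of_pow_mul_pow_eq_pow {x y z : FreeMonoid A} {n j l : ℕ}
    (hn : 2 ≤ n) (hj : 2 ≤ j) (hl : 2 ≤ l) (h : x ^ n * y ^ j = z ^ l) : Commute x y := by
  induction hN : (z ^ l).length using Nat.strong_induction_on generalizing x y z n j l with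
  | _ N ih =>
  by_cases hx : x = 1
  · rw [hx]; exact Commute.one_left y
  by_cases hy : y = 1
  · rw [hy]; exact Commute.one_right x
  have hx0 : (x ^ n).length ≠ 0 := by
    rw [length_pow_eq]
    exact mul_ne_zero (by omega) fun h => hx (length_eq_zero.1 h)
  have hy0 : (y ^ j).length ≠ 0 := by
    rw [length_pow_eq]
    exact mul_ne_zero (by omega) fun h => hy (length_eq_zero.1 h)
  have hlen := congrArg length h
  rw [hN, length_mul] at hlen
  obtain rfl | hl3 : l = 2 ∨ 3 ≤ l := by omega
  · rw [pow_two] at h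
    rcases le_total z.length (x ^ n).length with hle | hle
    · obtain ⟨t, ht, rfl⟩ := exists_eq_mul_of_mul_eq_mul h.symm hle
      obtain ⟨x', hx', h'⟩ :=
        exists_pow_eq_mul_swap (by omega) ((mul_assoc _ _ _).symm.trans ht.symm)
      have hx'n : (x' ^ n).length = (x ^ n).length := by rw [length_pow_eq, hx', length_pow_eq]
      have hyt : Commute y t :=
        ih (x' ^ n).length (by omega) hj le_rfl hn (by rw [pow_two, ← mul_assoc, h']) rfl
      refine commute_of_commute_pow_left (n := n) (by omega) ?_
      rw [ht]
      exact (hyt.symm.mul_left ((Commute.refl y).pow_left j)).mul_left hyt.symm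
    · obtain ⟨t, rfl, ht⟩ := exists_eq_mul_of_mul_eq_mul h hle
      obtain ⟨y', hy', h'⟩ := exists_pow_eq_mul_swap (by omega) ht.symm
      have hy'j : (y' ^ j).length = (y ^ j).length := by rw [length_pow_eq, hy', length_pow_eq]
      have hxt : Commute x t :=
        ih (y' ^ j).length (by omega) hn le_rfl hj (by rw [pow_two, ← mul_assoc, h']) rfl
      refine (commute_of_commute_pow_left (n := j) (by omega) ?_).symm
      rw [ht]
      exact hxt.symm.mul_left (((Commute.refl x).pow_left n).mul_left hxt.symm)
  · obtain ⟨r, m, hr, rfl⟩ := exists_isPrimitive_pow_eq z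
    have hm : m ≠ 0 := by
      rintro rfl
      simp only [pow_zero, one_pow, length_one] at hN
      omega
    rw [← pow_mul] at h
    exact hr.commute_of_pow_mul_pow_eq_pow hn hj (by nlinarith [Nat.pos_of_ne_zero hm]) h

end FreeMonoid

/-- If `x^i y^j x^k = z^ℓ` with `i + k ≥ 2`, `j ≥ 2` and `ℓ ≥ 2`, then `x, y, z`
pairwise commute. -/
theorem stmt9 {A : Type*} (x y z : FreeMonoid A) (i j k ℓ : ℕ)
    (hik : 2 ≤ i + k) (hj : 2 ≤ j) (hℓ : 2 ≤ ℓ)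
    (heq : x ^ i * y ^ j * x ^ k = z ^ ℓ) :
    x * y = y * x ∧ x * z = z * x ∧ y * z = z * y := by
  obtain ⟨z', -, h⟩ := FreeMonoid.exists_pow_eq_mul_swap (by omega) heq
  rw [← mul_assoc, ← pow_add, add_comm k i] at h
  have hxy : Commute x y := FreeMonoid.commute_of_pow_mul_pow_eq_pow hik hj hℓ h
  refine ⟨hxy, ?_, ?_⟩
  · refine (FreeMonoid.commute_of_commute_pow_left (n := ℓ) (by omega) ?_).symm
    rw [← heq]
    exact (((Commute.refl x).pow_left i).mul_left (hxy.symm.pow_left j)).mul_left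
      ((Commute.refl x).pow_left k)
  · refine (FreeMonoid.commute_of_commute_pow_left (n := ℓ) (by omega) ?_).symm
    rw [← heq]
    exact ((hxy.pow_left i).mul_left ((Commute.refl y).pow_left j)).mul_left
      (hxy.pow_left k)
end
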